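/- (Merging of Top Opinions) Fix β ∈ (0, 1). With P-probability 1 over sequences sampled from P, the following holds: for every sequence (S_t)_{t∈ℕ} of finite subsets of ℳ such that, for each t, (i) ∑_{Q∈S_t} w(Q | x_{<t}) > β, (ii) every Q ∈ S_t satisfies w(Q | x_{<t}) ≥ w(Q' | x_{<t}) for every Q' ∈ ℳ ∖ S_t, and (iii) for every Q ∈ S_t of minimal posterior weight among S_t, ∑_{Q'∈S_t∖{Q}} w(Q' | x_{<t}) ≤ β, one has lim_{t→∞} max_{Q∈S_t} d(P, Q | x_{<t}) = 0. -/

import Mathlib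

open MeasureTheory Filter

/-- The cylinder set of infinite sequences agreeing with `x` on the first `t` coordinates,
i.e. the set of sequences beginning with the prefix `x_{<t}`. -/
def cyl {X : Type*} (x : ℕ → X) (t : ℕ) : Set (ℕ → X) := {y | ∀ i < t, y i = x i}

/-- `Q(x_{<t})`: the `Q`-measure of the cylinder set of sequences beginning with `x_{<t}`,
as a real number. -/
noncomputable def prefProb {X : Type*} [MeasurableSpace X]
    (Q : Measure (ℕ → X)) (x : ℕ → X) (t : ℕ) : ℝ :=
  (Q (cyl x t)).toReal

/-- The posterior weight `w(Q i | x_{<t}) = w(Q i)·(Q i)(x_{<t}) / ∑_{j} w(Q j)·(Q j)(x_{<t})`. -/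
noncomputable def post {X ι : Type*} [MeasurableSpace X]
    (w : ι → ℝ) (Q : ι → Measure (ℕ → X)) (i : ι) (x : ℕ → X) (t : ℕ) : ℝ :=
  w i * prefProb (Q i) x t / ∑' j, w j * prefProb (Q j) x t

/-- `Q(ℰ | x_{<t})`: the conditional probability, given the prefix `x_{<t}`, that the next `k`
symbols form a string belonging to `ℰ ⊆ 𝒳^k`. -/
noncomputable def condProb {X : Type*} [MeasurableSpace X]
    (Q : Measure (ℕ → X)) (x : ℕ → X) (t k : ℕ) (E : Set (Fin k → X)) : ℝ :=
  (Q {y | y ∈ cyl x t ∧ (fun j : Fin k => y (t + j)) ∈ E}).toReal / prefProb Q x t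

/-- The `k`-step variation distance
`d_k(P, Q | x_{<t}) = max_{ℰ ⊆ 𝒳^k} |P(ℰ | x_{<t}) − Q(ℰ | x_{<t})|`. -/
noncomputable def dk {X : Type*} [MeasurableSpace X]
    (P Q : Measure (ℕ → X)) (x : ℕ → X) (t k : ℕ) : ℝ :=
  ⨆ E : Set (Fin k → X), |condProb P x t k E - condProb Q x t k E|

/-- The total variation distance `d(P, Q | x_{<t}) = lim_{k→∞} d_k(P, Q | x_{<t})`; since
`d_k` is non-decreasing in `k` and bounded by 1, the limit equals the supremum over `k`. -/
noncomputable def dTV {X : Type*} [MeasurableSpace X]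
    (P Q : Measure (ℕ → X)) (x : ℕ → X) (t : ℕ) : ℝ :=
  ⨆ k : ℕ, dk P Q x t k


theorem det_step {ι : Type*} [DecidableEq ι] (p D : ι → ℕ → ℝ) (f : ι → ℝ) (β : ℝ) (hβ1 : β < 1)
    (hp0 : ∀ i t, 0 ≤ p i t) (hp1 : ∀ t (F : Finset ι), ∑ i ∈ F, p i t ≤ 1)
    (hpf : ∀ i, Tendsto (p i) atTop (nhds (f i))) (hf : HasSum f 1)
    (hD : ∀ i, 0 < f i → Tendsto (D i) atTop (nhds 0))
    (S : ℕ → Finset ι)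
    (h2 : ∀ t, ∀ i ∈ S t, ∀ j ∉ S t, p j t ≤ p i t)
    (h3 : ∀ t, ∀ i ∈ S t, (∀ j ∈ S t, p i t ≤ p j t) → ∑ j ∈ (S t).erase i, p j t ≤ β)
    (hβ0 : 0 < β) (ε : ℝ) (hε : 0 < ε) :
    ∀ᶠ t in atTop, ∀ i ∈ S t, D i t < ε := by
  have hf0 : ∀ i, 0 ≤ f i := fun i => ge_of_tendsto' (hpf i) (hp0 i)
  have hbig : ∀ c < 1, ∃ F : Finset ι, c < ∑ i ∈ F, f i := fun c hc =>
    (hf.eventually (lt_mem_nhds hc)).exists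
  obtain ⟨F0, hF0⟩ := hbig β hβ1
  obtain ⟨F, hF, hFpos⟩ : ∃ F : Finset ι, β < ∑ i ∈ F, f i ∧ ∀ i ∈ F, 0 < f i := by
    refine ⟨F0.filter (fun i => 0 < f i), ?_, fun i hi => (Finset.mem_filter.1 hi).2⟩
    rw [Finset.sum_filter_of_ne]
    · exact hF0
    · intro i _ hi
      exact lt_of_le_of_ne (hf0 i) (Ne.symm hi)
  have hFne : F.Nonempty := by
    rw [Finset.nonempty_iff_ne_empty]
    rintro rfl
    simp at hF
    linarith
  obtain ⟨m, hm, hmin⟩ := Finset.exists_min_image F f hFne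
  set δ := f m with hδ
  have hδ0 : 0 < δ := hFpos m hm
  obtain ⟨G, hG⟩ := hbig (1 - δ / 2) (by linarith)
  have e1 : ∀ᶠ t in atTop, β < ∑ i ∈ F, p i t :=
    (tendsto_finsetSum F (fun i _ => hpf i)).eventually (lt_mem_nhds hF)
  have e2 : ∀ᶠ t in atTop, 1 - δ / 2 < ∑ i ∈ G, p i t :=
    (tendsto_finsetSum G (fun i _ => hpf i)).eventually (lt_mem_nhds hG)
  have e3 : ∀ᶠ t in atTop, ∀ i ∈ F, δ / 2 < p i t := by
    rw [Filter.eventually_all_finset]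
    intro i hi
    exact (hpf i).eventually (lt_mem_nhds (by linarith [hmin i hi]))
  have e4 : ∀ᶠ t in atTop, ∀ i ∈ G, (f i = 0 → p i t < δ / 2) ∧ (0 < f i → D i t < ε) := by
    rw [Filter.eventually_all_finset]
    intro i hi
    rcases (hf0 i).eq_or_lt with h | h
    · have := (hpf i).eventually (gt_mem_nhds (show f i < δ / 2 by linarith))
      filter_upwards [this] with t ht
      exact ⟨fun _ => ht, fun h' => by linarith⟩
    · have := (hD i h).eventually (gt_mem_nhds hε)
      filter_upwards [this] with t ht
      exact ⟨fun h' => by linarith, fun _ => ht⟩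
  filter_upwards [e1, e2, e3, e4] with t h1 h2' h3' h4 i hi
  have hpi : δ / 2 ≤ p i t := by
    by_contra! hlt
    obtain ⟨k, hk, hkmin⟩ := Finset.exists_min_image (S t) (fun j => p j t) ⟨i, hi⟩
    have hk2 : p k t < δ / 2 := (hkmin i hi).trans_lt hlt
    have hsub : F ⊆ (S t).erase k := by
      intro j hj
      rw [Finset.mem_erase]
      constructor
      · rintro rfl
        linarith [h3' j hj]
      · by_contra hjS
        linarith [h3' j hj, h2 t k hk j hjS]
    have := Finset.sum_le_sum_of_subset_of_nonneg (f := fun j => p j t) hsub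
      (fun j _ _ => hp0 j t)
    linarith [h3 t k hk hkmin]
  have hiG : i ∈ G := by
    by_contra hiG
    have := hp1 t (insert i G)
    rw [Finset.sum_insert hiG] at this
    linarith
  refine (h4 i hiG).2 (lt_of_le_of_ne (hf0 i) fun h => ?_)
  linarith [(h4 i hiG).1 h.symm]

theorem meas_cyl {X : Type*} [Fintype X] [MeasurableSpace X] [MeasurableSingletonClass X]
    (x : ℕ → X) (t : ℕ) : MeasurableSet (cyl x t) := by
  have : cyl x t = ⋂ i ∈ Finset.range t, (fun y : ℕ → X => y i) ⁻¹' {x i} := by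
    ext y; simp [cyl]
  rw [this]
  exact Finset.measurableSet_biInter _ fun i _ => measurable_pi_apply i (measurableSet_singleton _)

theorem meas_ev {X : Type*} [Fintype X] [MeasurableSpace X] [MeasurableSingletonClass X]
    (x : ℕ → X) (t k : ℕ) (E : Set (Fin k → X)) :
    MeasurableSet {y | y ∈ cyl x t ∧ (fun j : Fin k => y (t + j)) ∈ E} := by
  refine (meas_cyl x t).inter ?_
  have hm : Measurable (fun (y : ℕ → X) => fun j : Fin k => y (t + j)) := by fun_prop
  exact hm E.toFinite.measurableSet

/-- first `t` coordinates -/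
def fstc (X : Type*) (t : ℕ) (y : ℕ → X) : Fin t → X := fun i => y i

/-- the filtration of prefixes -/
def prefF (X : Type*) [MeasurableSpace X] :
    Filtration ℕ (MeasurableSpace.pi : MeasurableSpace (ℕ → X)) where
  seq t := MeasurableSpace.comap (fstc X t) MeasurableSpace.pi
  mono' s t hst := by
    have : fstc X s = (fun z : Fin t → X => fun i : Fin s => z (Fin.castLE hst i)) ∘ fstc X t := by
      ext y i; simp [fstc]
    show MeasurableSpace.comap _ _ ≤ MeasurableSpace.comap _ _
    rw [this, ← MeasurableSpace.comap_comp]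
    apply MeasurableSpace.comap_mono
    apply Measurable.comap_le
    fun_prop
  le' t := by
    apply Measurable.comap_le
    unfold fstc
    fun_prop

theorem prefF_iSup (X : Type*) [MeasurableSpace X] :
    (⨆ t, prefF X t) = (MeasurableSpace.pi : MeasurableSpace (ℕ → X)) := by
  refine le_antisymm (iSup_le fun t => (prefF X).le t) ?_
  refine iSup_le fun a => ?_
  refine le_trans ?_ (le_iSup _ (a + 1))
  have : (fun y : ℕ → X => y a) = (fun z : Fin (a+1) → X => z (Fin.last a)) ∘ fstc X (a+1) := by
    ext y; simp [fstc]
  show MeasurableSpace.comap _ _ ≤ MeasurableSpace.comap _ _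
  rw [this, ← MeasurableSpace.comap_comp]
  apply MeasurableSpace.comap_mono
  exact (measurable_pi_apply _).comap_le

theorem cyl_eq {X : Type*} (x : ℕ → X) (t : ℕ) : cyl x t = fstc X t ⁻¹' {fstc X t x} := by
  ext y
  simp only [cyl, fstc, Set.mem_ofPred_eq, Set.mem_preimage, Set.mem_singleton_iff, funext_iff]
  exact ⟨fun h i => h i i.2, fun h i hi => h ⟨i, hi⟩⟩

theorem condExp_cyl {X : Type*} [Fintype X] [MeasurableSpace X] [MeasurableSingletonClass X]
    (M : Measure (ℕ → X)) [IsProbabilityMeasure M] (f : (ℕ → X) → ℝ) (hf : Integrable f M)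
    (x : ℕ → X) (t : ℕ) :
    (M[f|prefF X t]) x * M.real (cyl x t) = ∫ y in cyl x t, f y ∂M := by
  have hC : MeasurableSet[prefF X t] (cyl x t) := by
    rw [cyl_eq]
    exact ⟨_, measurableSet_singleton _, rfl⟩
  rw [← setIntegral_condExp ((prefF X).le t) hf hC]
  have hconst : ∀ y ∈ cyl x t, (M[f|prefF X t]) y = (M[f|prefF X t]) x := by
    intro y hy
    have hm : Measurable[prefF X t] (M[f|prefF X t]) := stronglyMeasurable_condExp.measurable
    obtain ⟨s, -, hs⟩ := hm (measurableSet_singleton ((M[f|prefF X t]) x))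
    have hx : x ∈ fstc X t ⁻¹' s := by rw [hs]; simp
    rw [cyl_eq] at hy
    have hy' : y ∈ fstc X t ⁻¹' s := by
      have : fstc X t y = fstc X t x := hy
      rw [Set.mem_preimage, this]; exact hx
    rw [hs] at hy'
    exact hy'
  rw [setIntegral_congr_fun (meas_cyl x t) hconst]
  simp [mul_comm]

theorem cyl_pos {X : Type*} [Fintype X] [MeasurableSpace X] [MeasurableSingletonClass X]
    (M : Measure (ℕ → X)) [IsProbabilityMeasure M] :
    ∀ᵐ x ∂M, ∀ t, 0 < M.real (cyl x t) := by
  rw [ae_all_iff]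
  intro t
  have hsub : {x : ℕ → X | ¬ 0 < M.real (cyl x t)} ⊆
      ⋃ z ∈ {z : Fin t → X | M (fstc X t ⁻¹' {z}) = 0}, fstc X t ⁻¹' {z} := by
    intro x hx
    simp only [Set.mem_iUnion]
    refine ⟨fstc X t x, ?_, rfl⟩
    have h0 : M.real (cyl x t) = 0 := le_antisymm (not_lt.1 hx) measureReal_nonneg
    rw [measureReal_eq_zero_iff] at h0
    rw [cyl_eq] at h0
    exact h0
  refine measure_mono_null hsub ?_
  rw [measure_biUnion_null_iff (Set.to_countable _)]
  exact fun z hz => hz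

/-- Blackwell-Dubins type bound. -/
theorem bd_bound {X : Type*} [Fintype X] [MeasurableSpace X] [MeasurableSingletonClass X]
    (M : Measure (ℕ → X)) [IsProbabilityMeasure M] (f : (ℕ → X) → ℝ) (hfm : Measurable f)
    (hf0 : ∀ y, 0 ≤ f y) (hf1 : ∀ y, f y ≤ 1) (C A : Set (ℕ → X)) (hC : MeasurableSet C)
    (hA : MeasurableSet A) (hAC : A ⊆ C) (hMC : 0 < M.real C) (c v η : ℝ) (hc : 0 < c) (hη : 0 < η)
    (h1 : c * M.real C = ∫ y in C, f y ∂M) (h2 : v * M.real C = ∫ y in C, f y ^ 2 ∂M) :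
    |(∫ y in A, f y ∂M) / (∫ y in C, f y ∂M) - M.real A / M.real C| ≤
      (η + (v - c ^ 2) / η) / c := by
  have hi : Integrable f M := Integrable.of_bound hfm.aestronglyMeasurable 1
    (Eventually.of_forall fun y => by rw [Real.norm_eq_abs, abs_of_nonneg (hf0 y)]; exact hf1 y)
  have hi2 : Integrable (fun y => f y ^ 2) M :=
    Integrable.of_bound (hfm.pow_const 2).aestronglyMeasurable 1
    (Eventually.of_forall fun y => by
      rw [Real.norm_eq_abs, abs_of_nonneg (by positivity)]; exact pow_le_one₀ (hf0 y) (hf1 y))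
  have hid : Integrable (fun y => f y - c) M := hi.sub (integrable_const c)
  have hsq : Integrable (fun y => (f y - c) ^ 2) M := by
    have := (hi2.sub (hi.const_mul (2 * c))).add (integrable_const (c ^ 2))
    refine this.congr (Eventually.of_forall fun y => ?_)
    simp only [Pi.add_apply, Pi.sub_apply]
    ring
  have e1 : (∫ y in A, f y ∂M) / (∫ y in C, f y ∂M) - M.real A / M.real C =
      (∫ y in A, (f y - c) ∂M) / (c * M.real C) := by
    rw [integral_sub hi.integrableOn (integrable_const c), ← h1]
    simp only [integral_const, smul_eq_mul, measureReal_restrict_apply_univ]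
    field_simp
  have e2 : |∫ y in A, (f y - c) ∂M| ≤ ∫ y in C, |f y - c| ∂M :=
    (abs_integral_le_integral_abs).trans
      (setIntegral_mono_set hid.abs.integrableOn (Eventually.of_forall fun y => abs_nonneg _)
        (Eventually.of_forall hAC))
  have e3 : ∫ y in C, |f y - c| ∂M ≤ ∫ y in C, (η + (f y - c) ^ 2 * η⁻¹) ∂M := by
    refine setIntegral_mono hid.abs.integrableOn
      ((integrable_const η).add (hsq.mul_const _)).integrableOn fun y => ?_
    show |f y - c| ≤ η + (f y - c) ^ 2 * η⁻¹
    rw [← sq_abs, ← div_eq_mul_inv]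
    have h : η + |f y - c| ^ 2 / η - |f y - c| = ((|f y - c| - η / 2) ^ 2 + 3 / 4 * η ^ 2) / η := by
      field_simp
      ring
    have : 0 ≤ ((|f y - c| - η / 2) ^ 2 + 3 / 4 * η ^ 2) / η := by positivity
    linarith
  have e4 : ∫ y in C, (f y - c) ^ 2 ∂M = (v - c ^ 2) * M.real C := by
    have : ∀ y, (f y - c) ^ 2 = f y ^ 2 - 2 * c * f y + c ^ 2 := fun y => by ring
    simp_rw [this]
    have hA : Integrable (fun y => f y ^ 2 - 2 * c * f y) M := hi2.sub (hi.const_mul _)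
    rw [integral_add hA.integrableOn (integrable_const _),
      integral_sub hi2.integrableOn (hi.const_mul _).integrableOn, integral_const_mul, ← h1, ← h2]
    simp
    ring
  have e5 : ∫ y in C, (η + (f y - c) ^ 2 * η⁻¹) ∂M = (η + (v - c ^ 2) / η) * M.real C := by
    rw [integral_add (integrable_const _) (hsq.mul_const _).integrableOn, integral_mul_const, e4]
    simp
    field_simp
  rw [e1, abs_div, abs_of_pos (mul_pos hc hMC)]
  rw [div_le_div_iff₀ (mul_pos hc hMC) hc]
  have := (e2.trans e3).trans_eq e5
  nlinarith

/-- the mixture -/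
noncomputable def mixM {X ι : Type*} [MeasurableSpace X]
    (w : ι → ℝ) (Q : ι → Measure (ℕ → X)) : Measure (ℕ → X) :=
  Measure.sum fun i => ENNReal.ofReal (w i) • Q i

theorem mixM_real {X ι : Type*} [MeasurableSpace X] [Countable ι]
    (w : ι → ℝ) (Q : ι → Measure (ℕ → X)) (hQ : ∀ i, IsProbabilityMeasure (Q i))
    (hw : ∀ i, 0 < w i) (A : Set (ℕ → X)) :
    (mixM w Q).real A = ∑' i, w i * (Q i).real A := by
  rw [measureReal_def, mixM, Measure.sum_apply_of_countable, ENNReal.tsum_toReal_eq]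
  · congr 1
    ext i
    simp [measureReal_def, (hw i).le]
  · intro i
    simp [ENNReal.mul_eq_top]

theorem mixM_prob {X ι : Type*} [MeasurableSpace X] [Countable ι]
    (w : ι → ℝ) (Q : ι → Measure (ℕ → X)) (hQ : ∀ i, IsProbabilityMeasure (Q i))
    (hw : ∀ i, 0 < w i) (hw1 : ∑' i, w i = 1) : IsProbabilityMeasure (mixM w Q) := by
  have hs : Summable w := by
    by_contra h
    rw [tsum_eq_zero_of_not_summable h] at hw1
    norm_num at hw1
  constructor
  rw [mixM, Measure.sum_apply_of_countable]
  simp only [Measure.smul_apply, measure_univ, smul_eq_mul, mul_one]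
  rw [← ENNReal.ofReal_tsum_of_nonneg (fun i => (hw i).le) hs, hw1, ENNReal.ofReal_one]

theorem exists_dens {X ι : Type*} [MeasurableSpace X] [Countable ι]
    (w : ι → ℝ) (Q : ι → Measure (ℕ → X)) (hQ : ∀ i, IsProbabilityMeasure (Q i))
    (hw : ∀ i, 0 < w i) (hw1 : ∑' i, w i = 1) :
    ∃ f : ι → (ℕ → X) → ℝ, (∀ i, Measurable (f i)) ∧ (∀ i y, 0 ≤ f i y) ∧ (∀ i y, f i y ≤ 1) ∧
      (∀ i A, MeasurableSet A → ∫ y in A, f i y ∂(mixM w Q) = w i * (Q i).real A) ∧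
      ∀ᵐ x ∂(mixM w Q), HasSum (fun i => f i x) 1 := by
  have := mixM_prob w Q hQ hw hw1
  set M := mixM w Q with hM
  let ν : ι → Measure (ℕ → X) := fun i => ENNReal.ofReal (w i) • Q i
  have hνf : ∀ i, IsFiniteMeasure (ν i) := fun i =>
    Measure.smul_finite _ ENNReal.ofReal_ne_top
  have hac : ∀ i, ν i ≪ M := fun i => (Measure.le_sum ν i).absolutelyContinuous
  have hsum : ∀ᵐ x ∂M, ∑' i, (ν i).rnDeriv M x = 1 := by
    have h1 : M.withDensity (∑' i, (ν i).rnDeriv M) = M.withDensity 1 := by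
      rw [withDensity_tsum (fun i => Measure.measurable_rnDeriv _ _), withDensity_one]
      simp_rw [fun i => Measure.withDensity_rnDeriv_eq _ _ (hac i)]
      rfl
    have h2 : M.withDensity 1 = M.withDensity (∑' i, (ν i).rnDeriv M) := h1.symm
    rw [withDensity_eq_iff (by fun_prop)
      (by exact (Measurable.ennreal_tsum' fun i => Measure.measurable_rnDeriv _ _).aemeasurable)
      (by simp)] at h2
    filter_upwards [h2] with x hx
    rw [ENNReal.tsum_apply] at hx
    exact hx.symm
  have hle : ∀ᵐ x ∂M, ∀ i, (ν i).rnDeriv M x ≤ 1 := by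
    filter_upwards [hsum] with x hx i
    exact hx ▸ ENNReal.le_tsum i
  have hle' : ∀ᵐ x ∂M, ∀ i, min ((ν i).rnDeriv M x).toReal 1 = ((ν i).rnDeriv M x).toReal := by
    filter_upwards [hle] with x hx i
    exact min_eq_left (ENNReal.toReal_le_of_le_ofReal zero_le_one (by simpa using hx i))
  refine ⟨fun i x => min ((ν i).rnDeriv M x).toReal 1, ?_, ?_, ?_, ?_, ?_⟩
  · intro i
    exact (Measure.measurable_rnDeriv _ _).ennreal_toReal.min measurable_const
  · intro i y; positivity
  · intro i y; exact min_le_right _ _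
  · intro i A hA
    rw [setIntegral_congr_ae hA (g := fun x => ((ν i).rnDeriv M x).toReal)
      (hle'.mono fun x hx _ => hx i), Measure.setIntegral_toReal_rnDeriv (hac i)]
    simp [ν, measureReal_def, (hw i).le]
  · filter_upwards [hsum, hle, hle'] with x hx h1 h2
    simp_rw [h2]
    have hne : ∀ i, (ν i).rnDeriv M x ≠ ⊤ := fun i => ne_top_of_le_ne_top ENNReal.one_ne_top (h1 i)
    have hs : Summable fun i => ((ν i).rnDeriv M x).toReal :=
      ENNReal.summable_toReal (by rw [hx]; simp)
    have := hs.hasSum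
    rwa [← ENNReal.tsum_toReal_eq hne, hx, ENNReal.toReal_one] at this

theorem merge_pt {X : Type*} [Fintype X] [MeasurableSpace X] [MeasurableSingletonClass X]
    (M : Measure (ℕ → X)) [IsProbabilityMeasure M] (w : ℝ) (hw : 0 < w) (q : Measure (ℕ → X))
    (f : (ℕ → X) → ℝ) (hfm : Measurable f)
    (hf0 : ∀ y, 0 ≤ f y) (hf1 : ∀ y, f y ≤ 1)
    (hfq : ∀ A, MeasurableSet A → ∫ y in A, f y ∂M = w * q.real A) (x : ℕ → X)
    (hx : ∀ t, 0 < M.real (cyl x t)) (hfx : 0 < f x)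
    (h1 : Tendsto (fun t => (M[f|prefF X t]) x) atTop (nhds (f x)))
    (h2 : Tendsto (fun t => (M[fun y => f y ^ 2|prefF X t]) x) atTop (nhds (f x ^ 2)))
    (ε : ℝ) (hε : 0 < ε) :
    ∀ᶠ t in atTop, ∀ k E, |condProb q x t k E - condProb M x t k E| ≤ ε := by
  have hi : Integrable f M := Integrable.of_bound hfm.aestronglyMeasurable 1
    (Eventually.of_forall fun y => by rw [Real.norm_eq_abs, abs_of_nonneg (hf0 y)]; exact hf1 y)
  have hi2 : Integrable (fun y => f y ^ 2) M :=
    Integrable.of_bound (hfm.pow_const 2).aestronglyMeasurable 1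
    (Eventually.of_forall fun y => by
      rw [Real.norm_eq_abs, abs_of_nonneg (by positivity)]; exact pow_le_one₀ (hf0 y) (hf1 y))
  set η := ε * f x / 2 with hη
  have hη0 : 0 < η := by positivity
  have hlim : Tendsto (fun t => (η + ((M[fun y => f y ^ 2|prefF X t]) x -
      ((M[f|prefF X t]) x) ^ 2) / η) / (M[f|prefF X t]) x) atTop
      (nhds ((η + (f x ^ 2 - f x ^ 2) / η) / f x)) :=
    (((h2.sub (h1.pow 2)).div_const η).const_add η).div h1 hfx.ne'
  have hlt : (η + (f x ^ 2 - f x ^ 2) / η) / f x < ε := by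
    have : (η + (f x ^ 2 - f x ^ 2) / η) / f x = ε / 2 := by
      rw [sub_self, zero_div, add_zero, hη]; field_simp
    linarith
  filter_upwards [hlim.eventually (gt_mem_nhds hlt), h1.eventually (lt_mem_nhds hfx)]
    with t ht hc k E
  refine le_trans ?_ ht.le
  have hb := bd_bound M f hfm hf0 hf1 (cyl x t)
    {y | y ∈ cyl x t ∧ (fun j : Fin k => y (t + j)) ∈ E} (meas_cyl x t) (meas_ev x t k E)
    (fun y hy => hy.1) (hx t) _ _ η hc hη0 (condExp_cyl M f hi x t) (condExp_cyl M _ hi2 x t)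
  rw [hfq _ (meas_cyl x t), hfq _ (meas_ev x t k E), mul_div_mul_left _ _ hw.ne'] at hb
  exact hb

theorem dTV_nonneg {X : Type*} [MeasurableSpace X] (P Q : Measure (ℕ → X)) (x : ℕ → X) (t : ℕ) :
    0 ≤ dTV P Q x t :=
  Real.iSup_nonneg fun _ => Real.iSup_nonneg fun _ => abs_nonneg _

theorem main_aux
    {X : Type*} [Fintype X] [MeasurableSpace X] [MeasurableSingletonClass X]
    {ι : Type*} [Countable ι] [DecidableEq ι]
    (Q : ι → Measure (ℕ → X)) (hQ : ∀ i, IsProbabilityMeasure (Q i))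
    (w : ι → ℝ) (hw : ∀ i, 0 < w i) (hw1 : ∑' i, w i = 1)
    (i₀ : ι) (β : ℝ) (hβ : β ∈ Set.Ioo (0:ℝ) 1) :
    ∀ᵐ x ∂(Q i₀), ∀ S : ℕ → Finset ι,
      (∀ t, ∀ i ∈ S t, ∀ j ∉ S t, post w Q j x t ≤ post w Q i x t) →
      (∀ t, ∀ i ∈ S t, (∀ j ∈ S t, post w Q i x t ≤ post w Q j x t) →
        ∑ j ∈ (S t).erase i, post w Q j x t ≤ β) →
      Tendsto (fun t => ⨆ i ∈ S t, dTV (Q i₀) (Q i) x t) atTop (nhds 0) := by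
  have := mixM_prob w Q hQ hw hw1
  obtain ⟨f, hfm, hf0, hf1, hfq, hfs⟩ := exists_dens w Q hQ hw hw1
  have hpos := cyl_pos (mixM w Q)
  have hreal := mixM_real w Q hQ hw
  set M := mixM w Q with hM
  have hi : ∀ i, Integrable (f i) M := fun i =>
    Integrable.of_bound (hfm i).aestronglyMeasurable 1
    (Eventually.of_forall fun y => by
      rw [Real.norm_eq_abs, abs_of_nonneg (hf0 i y)]; exact hf1 i y)
  have hi2 : ∀ i, Integrable (fun y => f i y ^ 2) M := fun i =>
    Integrable.of_bound ((hfm i).pow_const 2).aestronglyMeasurable 1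
    (Eventually.of_forall fun y => by
      rw [Real.norm_eq_abs, abs_of_nonneg (by positivity)]; exact pow_le_one₀ (hf0 i y) (hf1 i y))
  have hL1 : ∀ᵐ x ∂M, ∀ i, Tendsto (fun t => (M[f i|prefF X t]) x) atTop (nhds (f i x)) := by
    rw [ae_all_iff]
    intro i
    refine (hi i).tendsto_ae_condExp ?_
    rw [prefF_iSup]
    exact (hfm i).stronglyMeasurable
  have hL2 : ∀ᵐ x ∂M, ∀ i, Tendsto (fun t => (M[fun y => f i y ^ 2|prefF X t]) x) atTop
      (nhds (f i x ^ 2)) := by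
    rw [ae_all_iff]
    intro i
    refine (hi2 i).tendsto_ae_condExp ?_
    rw [prefF_iSup]
    exact ((hfm i).pow_const 2).stronglyMeasurable
  have hac : Q i₀ ≪ M := by
    refine Measure.AbsolutelyContinuous.mk fun A hA h0 => ?_
    have h := hfq i₀ A hA
    rw [setIntegral_measure_zero _ h0] at h
    have h' := (mul_eq_zero.1 h.symm).resolve_left (hw i₀).ne'
    rwa [measureReal_eq_zero_iff] at h'
  have hf0pos : ∀ᵐ x ∂(Q i₀), 0 < f i₀ x := by
    have hA : MeasurableSet {x | ¬ 0 < f i₀ x} := (measurableSet_lt measurable_const (hfm i₀)).compl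
    have h := hfq i₀ _ hA
    have hz : ∫ y in {x | ¬ 0 < f i₀ x}, f i₀ y ∂M = 0 := by
      refine setIntegral_eq_zero_of_forall_eq_zero fun y hy => ?_
      exact le_antisymm (not_lt.1 hy) (hf0 i₀ y)
    rw [hz] at h
    have h' := (mul_eq_zero.1 h.symm).resolve_left (hw i₀).ne'
    rwa [measureReal_eq_zero_iff] at h'
  filter_upwards [hac.ae_le hpos, hac.ae_le hfs, hac.ae_le hL1, hac.ae_le hL2, hf0pos]
    with x hx hs h1 h2 hx0 S hS2 hS3
  have hs' : Summable w := by
    by_contra h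
    rw [tsum_eq_zero_of_not_summable h] at hw1
    norm_num at hw1
  have hws : ∀ t, Summable fun j => w j * (Q j).real (cyl x t) := fun t =>
    Summable.of_nonneg_of_le (fun j => mul_nonneg (hw j).le measureReal_nonneg)
      (fun j => mul_le_of_le_one_right (hw j).le measureReal_le_one) hs'
  have hpost : ∀ i t, post w Q i x t = w i * (Q i).real (cyl x t) / M.real (cyl x t) := by
    intro i t
    rw [hreal]
    rfl
  have hpc : ∀ i t, post w Q i x t = (M[f i|prefF X t]) x := by
    intro i t
    rw [hpost, ← hfq i _ (meas_cyl x t), ← condExp_cyl M (f i) (hi i) x t,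
      mul_div_cancel_right₀ _ (hx t).ne']
  have key : ∀ ε > 0, ∀ᶠ t in atTop, ∀ i ∈ S t, dTV (Q i₀) (Q i) x t < ε := by
    refine fun ε hε => det_step (fun i t => post w Q i x t) (fun i t => dTV (Q i₀) (Q i) x t)
      (fun i => f i x) β hβ.2 ?_ ?_ ?_ hs ?_ S hS2 hS3 hβ.1 ε hε
    · intro i t
      rw [hpost]
      exact div_nonneg (mul_nonneg (hw i).le measureReal_nonneg) measureReal_nonneg
    · intro t F
      simp_rw [hpost]
      rw [← Finset.sum_div, div_le_one (hx t), hreal]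
      exact (hws t).sum_le_tsum F fun j _ => mul_nonneg (hw j).le measureReal_nonneg
    · intro i
      exact (h1 i).congr fun t => (hpc i t).symm
    · intro i hfi
      rw [Metric.tendsto_nhds]
      intro ε hε
      have a1 := merge_pt M (w i) (hw i) (Q i) (f i) (hfm i) (hf0 i) (hf1 i) (hfq i) x hx hfi
        (h1 i) (h2 i) (ε / 3) (by positivity)
      have a0 := merge_pt M (w i₀) (hw i₀) (Q i₀) (f i₀) (hfm i₀) (hf0 i₀) (hf1 i₀) (hfq i₀) x
        hx hx0 (h1 i₀) (h2 i₀) (ε / 3) (by positivity)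
      filter_upwards [a1, a0] with t b1 b0
      rw [Real.dist_eq, sub_zero, abs_of_nonneg (dTV_nonneg _ _ _ _)]
      have : dTV (Q i₀) (Q i) x t ≤ ε / 3 + ε / 3 := by
        refine ciSup_le fun k => ciSup_le fun E => ?_
        have c1 := abs_le.1 (b1 k E)
        have c0 := abs_le.1 (b0 k E)
        rw [abs_le]
        constructor <;> linarith [c1.1, c1.2, c0.1, c0.2]
      linarith
  rw [Metric.tendsto_nhds]
  intro ε hε
  filter_upwards [key (ε / 2) (by positivity)] with t ht
  have hnn : 0 ≤ ⨆ i ∈ S t, dTV (Q i₀) (Q i) x t :=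
    Real.iSup_nonneg fun i => Real.iSup_nonneg fun _ => dTV_nonneg _ _ _ _
  rw [Real.dist_eq, sub_zero, abs_of_nonneg hnn]
  have : ⨆ i ∈ S t, dTV (Q i₀) (Q i) x t ≤ ε / 2 :=
    Real.iSup_le (fun i => Real.iSup_le (fun hi => (ht i hi).le) (by positivity)) (by positivity)
  linarith

/-- **Merging of Top Opinions.** Fix `β ∈ (0,1)`. With probability 1 over sequences sampled
from the true measure `P = Q i₀ ∈ ℳ`: for every sequence `(S t)` of finite subsets of `ℳ`
such that for each `t` (i) the total posterior weight of `S t` exceeds `β`, (ii) every member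
of `S t` has posterior weight at least that of every non-member, and (iii) for every member of
minimal posterior weight among `S t`, removing it brings the total posterior weight to at
most `β`, the maximal total variation distance `max_{Q ∈ S t} d(P, Q | x_{<t})` tends to 0. -/
theorem merging_of_top_opinions
    {X : Type*} [Fintype X] [Nonempty X] [MeasurableSpace X] [MeasurableSingletonClass X]
    {ι : Type*} [Countable ι] [DecidableEq ι]
    (Q : ι → Measure (ℕ → X)) (hQ : ∀ i, IsProbabilityMeasure (Q i))
    (w : ι → ℝ) (hw : ∀ i, 0 < w i) (hw1 : ∑' i, w i = 1)
    (i₀ : ι) (β : ℝ) (hβ : β ∈ Set.Ioo (0:ℝ) 1) :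
    ∀ᵐ x ∂(Q i₀), ∀ S : ℕ → Finset ι,
      (∀ t, β < ∑ i ∈ S t, post w Q i x t) →
      (∀ t, ∀ i ∈ S t, ∀ j ∉ S t, post w Q j x t ≤ post w Q i x t) →
      (∀ t, ∀ i ∈ S t, (∀ j ∈ S t, post w Q i x t ≤ post w Q j x t) →
        ∑ j ∈ (S t).erase i, post w Q j x t ≤ β) →
      Tendsto (fun t => ⨆ i ∈ S t, dTV (Q i₀) (Q i) x t) atTop (nhds 0) := by
  filter_upwards [main_aux Q hQ w hw hw1 i₀ β hβ] with x hx S _ h2 h3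
  exact hx S h2 h3
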